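/- Let I_1, I_2, …, I_N be squarefree monomial ideals of S = k[x_1,…,x_n] whose minimal generators contain no common variable, and suppose the least common multiple of the minimal generators of each I_r has degree q_r. Then for all i ≥ 0, b_{i, q_1+⋯+q_N}(S/(I_1 + I_2 + ⋯ + I_N)) = Σ_{u_1+⋯+u_N = i} b_{u_1,q_1}(S/I_1) ⋯ b_{u_N,q_N}(S/I_N). -/

import Mathlib

open MvPolynomial Finsupp

noncomputable section

abbrev ResIdx {σ : Type} (b : (σ →₀ ℕ) →₀ ℕ) : Type := Σ m : σ →₀ ℕ, Fin (b m)

abbrev ResMod (k : Type) (σ : Type) [Field k] (b : (σ →₀ ℕ) →₀ ℕ) : Type :=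
  ResIdx b →₀ MvPolynomial σ k

/-- A minimal multigraded free resolution `⋯ → F₁ → F₀ —ε→ S/I → 0` of the
quotient `S/I` of `S = k[x_i : i ∈ σ]` by an ideal `I`.  `β i m` is the number
of free summands `S(-m)` in homological degree `i`, i.e. the multigraded Betti
number `b_{i,m}(S/I)`. -/
structure MinimalMultigradedFreeResolutionQuot (k σ : Type) [Field k]
    (I : Ideal (MvPolynomial σ k)) : Type where
  β : ℕ → ((σ →₀ ℕ) →₀ ℕ)
  d : ∀ i : ℕ, ResMod k σ (β (i + 1)) →ₗ[MvPolynomial σ k] ResMod k σ (β i)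
  ε : ResMod k σ (β 0) →ₗ[MvPolynomial σ k] (MvPolynomial σ k ⧸ I)
  surj_ε : Function.Surjective ε
  exact0 : LinearMap.ker ε = LinearMap.range (d 0)
  exact : ∀ i, LinearMap.ker (d i) = LinearMap.range (d (i + 1))
  homog_ε : ∀ p : ResIdx (β 0), ∃ c : MvPolynomial σ k,
      Ideal.Quotient.mk I c = ε (Finsupp.single p 1) ∧
      ∀ μ ∈ c.support, μ = p.1
  homog_d : ∀ i, ∀ p : ResIdx (β (i + 1)), ∀ q : ResIdx (β i),
      ∀ μ ∈ ((d i (Finsupp.single p 1)) q).support, q.1 + μ = p.1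
  minimal : ∀ i, ∀ p : ResIdx (β (i + 1)), ∀ q : ResIdx (β i),
      MvPolynomial.coeff 0 ((d i (Finsupp.single p 1)) q) = 0

def totalDeg {σ : Type} (m : σ →₀ ℕ) : ℕ := m.sum fun _ e => e

def MinimalMultigradedFreeResolutionQuot.gradedBetti {k σ : Type} [Field k]
    {I : Ideal (MvPolynomial σ k)} (R : MinimalMultigradedFreeResolutionQuot k σ I)
    (i : ℕ) (j : ℤ) : ℕ :=
  ∑ m ∈ (R.β i).support.filter (fun m => (totalDeg m : ℤ) = j), R.β i m

end

section Abstract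
open Module

/-- span of the basis vectors satisfying a predicate -/
def Sp {k P C : Type} [Field k] [AddCommGroup C] [Module k C] (b : Basis P k C) (Q : P → Prop) :
    Submodule k C := Submodule.span k (b '' {p | Q p})

lemma Sp_basis {k P C : Type} [Field k] [AddCommGroup C] [Module k C] (b : Basis P k C)
    {Q : P → Prop} {p : P} (h : Q p) : b p ∈ Sp b Q :=
  Submodule.subset_span ⟨p, h, rfl⟩

lemma Sp_mono {k P C : Type} [Field k] [AddCommGroup C] [Module k C] {b : Basis P k C}
    {Q Q' : P → Prop} (h : ∀ p, Q p → Q' p) {v : C} (hv : v ∈ Sp b Q) : v ∈ Sp b Q' :=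
  Submodule.span_mono (Set.image_mono h) hv

lemma Sp_map {k P C C' : Type} [Field k] [AddCommGroup C] [Module k C] [AddCommGroup C']
    [Module k C'] {b : Basis P k C} {Q : P → Prop} (f : C →ₗ[k] C') (W : Submodule k C')
    (h : ∀ p, Q p → f (b p) ∈ W) {v : C} (hv : v ∈ Sp b Q) : f v ∈ W := by
  have : Sp b Q ≤ W.comap f := by
    apply Submodule.span_le.2
    rintro _ ⟨p, hp, rfl⟩
    exact h p hp
  exact this hv

lemma Sp_eq {k P C C' : Type} [Field k] [AddCommGroup C] [Module k C] [AddCommGroup C']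
    [Module k C'] {b : Basis P k C} {Q : P → Prop} (f g : C →ₗ[k] C')
    (h : ∀ p, Q p → f (b p) = g (b p)) {v : C} (hv : v ∈ Sp b Q) : f v = g v := by
  have := Sp_map (f - g) ⊥ (fun p hp => by simp [h p hp]) hv
  simpa [sub_eq_zero] using this

lemma Sp_repr {k P C : Type} [Field k] [AddCommGroup C] [Module k C] {b : Basis P k C}
    {Q : P → Prop} {v : C} (hv : v ∈ Sp b Q) {p : P} (hp : ¬ Q p) : b.repr v p = 0 := by
  have := (b.mem_span_image).1 hv
  by_contra h
  exact hp (this (by simpa using h))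

lemma Sp_iff {k P C : Type} [Field k] [AddCommGroup C] [Module k C] {b : Basis P k C}
    {Q : P → Prop} {v : C} : v ∈ Sp b Q ↔ ∀ p, b.repr v p ≠ 0 → Q p := by
  unfold Sp
  rw [b.mem_span_image]
  constructor
  · intro h p hp
    exact h (by simpa using hp)
  · intro h p hp
    exact h p (by simpa using hp)

structure IsAR {k D P C : Type} [Field k] [Lattice D] [AddCommGroup C] [Module k C]
    (b : Basis P k C) (hd : P → ℕ) (dg : P → D) (d : C →ₗ[k] C) (ε : C →ₗ[k] k) (M : Set D) :
    Prop where
  fin : ∀ i, {p | hd p = i}.Finite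
  dd : ∀ v, d (d v) = 0
  dL : ∀ p, d (b p) ∈ Sp b (fun q => hd q + 1 = hd p ∧ dg q < dg p)
  εhd : ∀ p, hd p ≠ 0 → ε (b p) = 0
  εd : ∀ m ∈ M, ∀ p, dg p ≤ m → ε (d (b p)) = 0
  exact : ∀ m, ∀ z ∈ Sp b (fun p => dg p ≤ m), d z = 0 → (m ∈ M → ε z = 0) →
    ∃ y ∈ Sp b (fun p => dg p ≤ m), d y = z
  surj : ∀ m ∈ M, ∃ c ∈ Sp b (fun p => hd p = 0 ∧ dg p ≤ m), ε c = 1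

variable {k D P C : Type} [Field k] [Lattice D] [AddCommGroup C] [Module k C]
    {b : Basis P k C} {hd : P → ℕ} {dg : P → D} {d : C →ₗ[k] C} {ε : C →ₗ[k] k} {M : Set D}

lemma IsAR.d0 (A : IsAR b hd dg d ε M) {c : C} {Q : P → Prop} (hQ : ∀ p, Q p → hd p = 0)
    (hc : c ∈ Sp b Q) : d c = 0 := by
  refine Sp_eq d 0 (fun p hp => ?_) hc
  have h := A.dL p
  have := Sp_map (b := b) LinearMap.id ⊥ (fun q hq => by have := hQ p hp; omega) h
  simpa using this

lemma IsAR.deg_le (A : IsAR b hd dg d ε M) (a : D) (hM : ∀ m, m ∈ M ↔ m ⊓ a ∈ M) (p : P) :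
    dg p ≤ a := by
  induction h : hd p using Nat.strong_induction_on generalizing p with
  | _ i ih =>
    have h1 : d (b p) ∈ Sp b (fun q => dg q ≤ dg p ⊓ a) := by
      refine Sp_mono (fun q hq => ?_) (A.dL p)
      exact le_inf hq.2.le (ih (hd q) (by omega) q rfl)
    obtain ⟨y, hy, hdy⟩ := A.exact _ _ h1 (A.dd _) (fun hm => A.εd _ ((hM _).2 hm) p le_rfl)
    have h2 : ∃ y' ∈ Sp b (fun q => dg q ≤ dg p ⊓ a), d y' = d (b p) ∧
        (dg p ∈ M → ε (b p - y') = 0) := by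
      by_cases hm : dg p ∈ M
      · obtain ⟨c, hc, hc1⟩ := A.surj _ ((hM _).1 hm)
        refine ⟨y + ε (b p - y) • c, ?_, ?_, ?_⟩
        · exact Submodule.add_mem _ hy (Submodule.smul_mem _ _ (Sp_mono (fun q hq => hq.2) hc))
        · rw [map_add, map_smul, A.d0 (fun _ h => h.1) hc, hdy]; simp
        · intro _
          simp [hc1]
      · exact ⟨y, hy, hdy, fun h => absurd h hm⟩
    obtain ⟨y', hy', hdy', hε⟩ := h2
    obtain ⟨w, hw, hdw⟩ := A.exact (dg p) (b p - y')
      (Submodule.sub_mem _ (Sp_basis b le_rfl) (Sp_mono (fun q hq => le_trans hq inf_le_left) hy'))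
      (by simp [hdy']) hε
    have h3 : d w ∈ Sp b (fun q => dg q < dg p) :=
      Sp_map d _ (fun q hq => Sp_mono (fun r hr => lt_of_lt_of_le hr.2 hq) (A.dL q)) hw
    have h4 := Sp_repr h3 (p := p) (lt_irrefl _)
    rw [hdw] at h4
    have h5 : b.repr y' p ≠ 0 := by
      intro h6
      simp [h6] at h4
    exact le_trans (Sp_iff.1 hy' p h5) inf_le_right

lemma IsAR.gexact (A : IsAR b hd dg d ε M) (m : D) (i : ℕ) (z : C)
    (hz : z ∈ Sp b (fun p => hd p = i ∧ dg p ≤ m)) (hdz : d z = 0) (hε : m ∈ M → ε z = 0) :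
    ∃ y ∈ Sp b (fun p => hd p = i + 1 ∧ dg p ≤ m), d y = z := by
  classical
  obtain ⟨y, hy, hdy⟩ := A.exact m z (Sp_mono (fun p hp => hp.2) hz) hdz hε
  let pr : ℕ → C →ₗ[k] C := fun j => b.constr k (fun p => if hd p = j then b p else 0)
  have prb : ∀ j p, pr j (b p) = if hd p = j then b p else 0 := fun j p => by simp [pr]
  refine ⟨pr (i+1) y, ?_, ?_⟩
  · refine Sp_map _ _ (fun p hp => ?_) hy
    rw [prb]
    split_ifs with h
    · exact Sp_basis b ⟨h, hp⟩
    · exact Submodule.zero_mem _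
  · have h1 : d ∘ₗ pr (i+1) = pr i ∘ₗ d := by
      refine b.ext (fun p => ?_)
      simp only [LinearMap.comp_apply, prb]
      split_ifs with h
      · refine (Sp_eq (pr i) LinearMap.id (fun q hq => ?_) (A.dL p)).symm
        rw [prb, if_pos (by omega)]; rfl
      · rw [map_zero]
        refine (Sp_eq (pr i) 0 (fun q hq => ?_) (A.dL p)).symm
        rw [prb, if_neg (by omega)]; rfl
    have h2 := LinearMap.congr_fun h1 y
    simp only [LinearMap.comp_apply] at h2
    rw [h2, hdy]
    refine Sp_eq (pr i) LinearMap.id (fun q hq => ?_) hz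
    rw [prb, if_pos hq.1]; rfl

variable {P' C' : Type} [AddCommGroup C'] [Module k C']
    {b' : Basis P' k C'} {hd' : P' → ℕ} {dg' : P' → D} {d' : C' →ₗ[k] C'} {ε' : C' →ₗ[k] k}

lemma IsAR.lift (A : IsAR b hd dg d ε M) (A' : IsAR b' hd' dg' d' ε' M) (hM : IsLowerSet M)
    (n : ℕ) : ∃ φ : C →ₗ[k] C', ∀ p, hd p ≤ n →
      φ (b p) ∈ Sp b' (fun q => hd' q = hd p ∧ dg' q ≤ dg p) ∧ d' (φ (b p)) = φ (d (b p)) ∧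
      (dg p ∈ M → ε' (φ (b p)) = ε (b p)) := by
  classical
  induction n with
  | zero =>
    have : ∀ p, ∃ c ∈ Sp b' (fun q => hd' q = 0 ∧ dg' q ≤ dg p), dg p ∈ M → ε' c = ε (b p) := by
      intro p
      by_cases h : dg p ∈ M
      · obtain ⟨c, hc, h1⟩ := A'.surj _ h
        exact ⟨ε (b p) • c, Submodule.smul_mem _ _ hc, fun _ => by simp [h1]⟩
      · exact ⟨0, Submodule.zero_mem _, fun h' => absurd h' h⟩
    choose c hc hc1 using this
    refine ⟨b.constr k c, fun p hp => ?_⟩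
    have hp0 : hd p = 0 := by omega
    simp only [Basis.constr_basis]
    refine ⟨by rw [hp0]; exact hc p, ?_, hc1 p⟩
    rw [A'.d0 (fun _ h => h.1) (hc p), A.d0 (Q := fun q => hd q = 0) (fun _ h => h)
      (Sp_basis b hp0), map_zero]
  | succ n ih =>
    obtain ⟨φ, hφ⟩ := ih
    have key : ∀ p, ∃ c, hd p = n + 1 → c ∈ Sp b' (fun q => hd' q = n + 1 ∧ dg' q ≤ dg p) ∧
        d' c = φ (d (b p)) := by
      intro p
      by_cases hp : hd p = n + 1
      · have hL := A.dL p
        obtain ⟨y, hy, hdy⟩ := A'.gexact (dg p) n (φ (d (b p)))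
          (Sp_map φ _ (fun q hq => Sp_mono (fun r hr => ⟨by omega, hr.2.trans hq.2.le⟩)
            (hφ q (by omega)).1) hL)
          (by
            have h := Sp_eq (d' ∘ₗ φ) (φ ∘ₗ d) (fun q hq => (hφ q (by omega)).2.1) hL
            simp only [LinearMap.comp_apply] at h
            rw [h, A.dd, map_zero])
          (by
            intro hm
            have h := Sp_eq (ε' ∘ₗ φ) ε
              (fun q hq => (hφ q (by omega)).2.2 (hM hq.2.le hm)) hL
            simp only [LinearMap.comp_apply] at h
            rw [h, A.εd _ hm p le_rfl])
        exact ⟨y, fun _ => ⟨hy, hdy⟩⟩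
      · exact ⟨0, fun h => absurd h hp⟩
    choose c hc using key
    let ψ : C →ₗ[k] C' := b.constr k (fun p => if hd p = n + 1 then c p else φ (b p))
    have ψb : ∀ p, ψ (b p) = if hd p = n + 1 then c p else φ (b p) := fun p => by simp [ψ]
    have ψd : ∀ p, hd p ≤ n + 1 → ψ (d (b p)) = φ (d (b p)) := by
      intro p hp
      refine Sp_eq ψ φ (fun q hq => ?_) (A.dL p)
      rw [ψb, if_neg (by omega)]
    refine ⟨ψ, fun p hp => ?_⟩
    rw [ψd p hp, ψb]
    split_ifs with h
    · rw [h]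
      refine ⟨(hc p h).1, (hc p h).2, fun _ => ?_⟩
      rw [A.εhd p (by omega)]
      exact Sp_eq ε' 0 (fun q hq => A'.εhd q (by omega)) (hc p h).1
    · exact hφ p (by omega)

lemma IsAR.homotopy (A : IsAR b hd dg d ε M) (n : ℕ) (g : C →ₗ[k] C)
    (hg : ∀ p, hd p ≤ n →
      g (b p) ∈ Sp b (fun q => hd q = hd p ∧ dg q ≤ dg p) ∧ d (g (b p)) = g (d (b p)) ∧
      (dg p ∈ M → ε (g (b p)) = 0)) :
    ∀ j ≤ n, ∃ h : C →ₗ[k] C, ∀ p, hd p ≤ j →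
      h (b p) ∈ Sp b (fun q => hd q = hd p + 1 ∧ dg q ≤ dg p) ∧
      d (h (b p)) = g (b p) - h (d (b p)) := by
  classical
  intro j
  induction j with
  | zero =>
    intro _
    have : ∀ p, ∃ y, hd p = 0 → y ∈ Sp b (fun q => hd q = 0 + 1 ∧ dg q ≤ dg p) ∧
        d y = g (b p) := by
      intro p
      by_cases hp : hd p = 0
      · have := hg p (by omega)
        rw [hp] at this
        obtain ⟨y, hy⟩ := A.gexact (dg p) 0 _ this.1 (A.d0 (fun _ h => h.1) this.1) this.2.2
        exact ⟨y, fun _ => hy⟩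
      · exact ⟨0, fun h => absurd h hp⟩
    choose c hc using this
    refine ⟨b.constr k c, fun p hp => ?_⟩
    have hp0 : hd p = 0 := by omega
    simp only [Basis.constr_basis]
    refine ⟨by rw [hp0]; exact (hc p hp0).1, ?_⟩
    rw [(hc p hp0).2, A.d0 (Q := fun q => hd q = 0) (fun _ h => h)
      (Sp_basis b hp0), map_zero, sub_zero]
  | succ j ih =>
    intro hj
    obtain ⟨φ, hφ⟩ := ih (by omega)
    have key : ∀ p, ∃ c, hd p = j + 1 → c ∈ Sp b (fun q => hd q = j + 1 + 1 ∧ dg q ≤ dg p) ∧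
        d c = g (b p) - φ (d (b p)) := by
      intro p
      by_cases hp : hd p = j + 1
      · have hL := A.dL p
        have hz : g (b p) - φ (d (b p)) ∈ Sp b (fun q => hd q = j + 1 ∧ dg q ≤ dg p) := by
          refine Submodule.sub_mem _ (by rw [← hp]; exact (hg p (by omega)).1) ?_
          exact Sp_map φ _ (fun q hq => Sp_mono (fun r hr => ⟨by omega, hr.2.trans hq.2.le⟩)
            (hφ q (by omega)).1) hL
        obtain ⟨y, hy, hdy⟩ := A.gexact (dg p) (j+1) (g (b p) - φ (d (b p))) hz
          (by
            have h := Sp_eq (d ∘ₗ φ) (g - φ ∘ₗ d) (fun q hq => (hφ q (by omega)).2) hL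
            simp only [LinearMap.comp_apply, LinearMap.sub_apply] at h
            rw [map_sub, h, A.dd, map_zero, (hg p (by omega)).2.1]; simp)
          (fun _ => Sp_eq ε 0 (fun q hq => A.εhd q (by omega)) hz)
        exact ⟨y, fun _ => ⟨hy, hdy⟩⟩
      · exact ⟨0, fun h => absurd h hp⟩
    choose c hc using key
    let ψ : C →ₗ[k] C := b.constr k (fun p => if hd p = j + 1 then c p else φ (b p))
    have ψb : ∀ p, ψ (b p) = if hd p = j + 1 then c p else φ (b p) := fun p => by simp [ψ]
    have ψd : ∀ p, hd p ≤ j + 1 → ψ (d (b p)) = φ (d (b p)) := by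
      intro p hp
      refine Sp_eq ψ φ (fun q hq => ?_) (A.dL p)
      rw [ψb, if_neg (by omega)]
    refine ⟨ψ, fun p hp => ?_⟩
    rw [ψd p hp, ψb]
    split_ifs with h
    · rw [h]
      exact hc p h
    · exact hφ p (by omega)

lemma IsAR.card_le (A : IsAR b hd dg d ε M) (A' : IsAR b' hd' dg' d' ε' M) (hM : IsLowerSet M)
    (i : ℕ) (m : D) :
    Nat.card {p // hd p = i ∧ dg p = m} ≤ Nat.card {p // hd' p = i ∧ dg' p = m} := by
  classical
  have : Finite {p // hd p = i ∧ dg p = m} := ((A.fin i).subset (fun p hp => hp.1)).to_subtype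
  have : Finite {p // hd' p = i ∧ dg' p = m} :=
    ((A'.fin i).subset (fun p hp => hp.1)).to_subtype
  let := Fintype.ofFinite {p // hd p = i ∧ dg p = m}
  let := Fintype.ofFinite {p // hd' p = i ∧ dg' p = m}
  obtain ⟨φ, hφ⟩ := A.lift A' hM i
  obtain ⟨ψ, hψ⟩ := A'.lift A hM i
  obtain ⟨h, hh⟩ := A.homotopy i (ψ ∘ₗ φ - LinearMap.id) (by
    intro p hp
    obtain ⟨h1, h2, h3⟩ := hφ p hp
    have hε := fun (hm : dg p ∈ M) => Sp_eq (ε ∘ₗ ψ) ε'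
      (fun q hq => (hψ q (by omega)).2.2 (hM hq.2 hm)) h1
    have hd2 := Sp_eq (d ∘ₗ ψ) (ψ ∘ₗ d') (fun q hq => (hψ q (by omega)).2.1) h1
    simp only [LinearMap.comp_apply] at hε hd2
    simp only [LinearMap.comp_apply, LinearMap.sub_apply, LinearMap.id_apply, map_sub]
    refine ⟨Submodule.sub_mem _ ?_ (Sp_basis b ⟨rfl, le_rfl⟩), ?_, ?_⟩
    · exact Sp_map ψ _ (fun q hq => Sp_mono (fun r hr => ⟨by omega, hr.2.trans hq.2⟩)
        (hψ q (by omega)).1) h1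
    · rw [hd2, h2]
    · intro hm
      rw [hε hm, h3 hm, sub_self]) i le_rfl
  let X := {p // hd p = i ∧ dg p = m}
  let X' := {p // hd' p = i ∧ dg' p = m}
  let pr : C →ₗ[k] (X → k) := LinearMap.pi (fun x => b.coord x.1)
  let pr' : C' →ₗ[k] (X' → k) := LinearMap.pi (fun x => b'.coord x.1)
  let inc : (X → k) →ₗ[k] C := Fintype.linearCombination k (fun x : X => b x.1)
  let inc' : (X' → k) →ₗ[k] C' := Fintype.linearCombination k (fun x : X' => b' x.1)
  have prlt : ∀ v ∈ Sp b (fun q => dg q < m), pr v = 0 := by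
    intro v hv
    ext x
    exact Sp_repr hv (by rw [x.2.2]; exact lt_irrefl _)
  have hpi : ∀ x : X', inc' (pr' (b' x.1)) = b' x.1 := by
    intro x
    have : pr' (b' x.1) = Pi.single x 1 := by
      ext y
      simp only [pr', LinearMap.pi_apply, Basis.coord_apply, Basis.repr_self,
        Pi.single_apply, Finsupp.single_apply]
      exact if_congr (by rw [Subtype.ext_iff, eq_comm]) rfl rfl
    rw [this]
    simp [inc']
  have hpr0 : ∀ q, ¬ (hd' q = i ∧ dg' q = m) → pr' (b' q) = 0 := by
    intro q hq
    ext y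
    simp only [pr', LinearMap.pi_apply, Basis.coord_apply, Basis.repr_self, Pi.zero_apply]
    rw [Finsupp.single_apply, if_neg]
    rintro rfl
    exact hq y.2
  have main : (pr ∘ₗ ψ ∘ₗ inc') ∘ₗ (pr' ∘ₗ φ ∘ₗ inc) = LinearMap.id := by
    refine LinearMap.pi_ext' (fun x => LinearMap.ext_ring ?_)
    have hinc : inc (Pi.single x 1) = b x.1 := by simp [inc]
    simp only [LinearMap.comp_apply, LinearMap.coe_single, hinc, LinearMap.id_apply]
    obtain ⟨h1, h2, h3⟩ := hφ x.1 x.2.1.le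
    obtain ⟨h4, h5⟩ := hh x.1 x.2.1.le
    have e1 : ψ (φ (b x.1)) - ψ (inc' (pr' (φ (b x.1)))) ∈ Sp b (fun q => dg q < m) := by
      refine Sp_map (ψ - ψ ∘ₗ inc' ∘ₗ pr') _ (fun q hq => ?_) h1
      simp only [LinearMap.sub_apply, LinearMap.comp_apply]
      have hqi : hd' q = i := hq.1.trans x.2.1
      by_cases hqm : dg' q = m
      · rw [hpi ⟨q, hqi, hqm⟩, sub_self]
        exact Submodule.zero_mem _
      · rw [hpr0 q (fun h => hqm h.2), map_zero, map_zero, sub_zero]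
        have : dg' q < m := lt_of_le_of_ne (x.2.2 ▸ hq.2) hqm
        exact Sp_mono (fun r hr => lt_of_le_of_lt hr.2 this) (hψ q hqi.le).1
    have e2 : ψ (φ (b x.1)) - b x.1 ∈ Sp b (fun q => dg q < m) := by
      have : ψ (φ (b x.1)) - b x.1 = d (h (b x.1)) + h (d (b x.1)) := by
        rw [h5]; simp
      rw [this]
      refine Submodule.add_mem _ ?_ ?_
      · refine Sp_map d _ (fun q hq => ?_) h4
        exact Sp_mono (fun r hr => lt_of_lt_of_le hr.2 (x.2.2 ▸ hq.2)) (A.dL q)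
      · refine Sp_map h _ (fun q hq => ?_) (A.dL x.1)
        have := x.2.1
        exact Sp_mono (fun r hr => lt_of_le_of_lt hr.2 (x.2.2 ▸ hq.2)) (hh q (by omega)).1
    have e3 := prlt _ e1
    have e4 := prlt _ e2
    rw [map_sub, sub_eq_zero] at e3 e4
    rw [← e3, e4]
    ext y
    simp only [pr, LinearMap.pi_apply, Basis.coord_apply, Basis.repr_self,
        Pi.single_apply, Finsupp.single_apply]
    exact if_congr (by rw [Subtype.ext_iff, eq_comm]) rfl rfl
  have inj : Function.Injective (pr' ∘ₗ φ ∘ₗ inc) := by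
    refine Function.LeftInverse.injective (g := pr ∘ₗ ψ ∘ₗ inc') (fun v => ?_)
    exact LinearMap.congr_fun main v
  have := LinearMap.finrank_le_finrank_of_injective inj
  rw [Module.finrank_fintype_fun_eq_card, Module.finrank_fintype_fun_eq_card] at this
  rwa [Nat.card_eq_fintype_card, Nat.card_eq_fintype_card]


open scoped TensorProduct

lemma IsAR.contract (A : IsAR b hd dg d ε M) (m : D) : ∃ h π : C →ₗ[k] C,
    (∀ v ∈ Sp b (fun p => dg p ≤ m), h v ∈ Sp b (fun p => dg p ≤ m)) ∧
    (∀ v ∈ Sp b (fun p => dg p ≤ m), d (h v) + h (d v) = v - π v) ∧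
    (∀ v ∈ Sp b (fun p => dg p ≤ m), π (d v) = 0) ∧
    (∀ v, π v ∈ Sp b (fun p => hd p = 0 ∧ dg p ≤ m)) ∧
    (m ∉ M → π = 0) ∧ ∃ c : C, ∀ v, π v = ε v • c := by
  obtain ⟨c, hc, hc1, hc2⟩ : ∃ c ∈ Sp b (fun p => hd p = 0 ∧ dg p ≤ m),
      (m ∈ M → ε c = 1) ∧ (m ∉ M → c = 0) := by
    by_cases hm : m ∈ M
    · obtain ⟨c, hc, h1⟩ := A.surj m hm
      exact ⟨c, hc, fun _ => h1, fun h => absurd hm h⟩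
    · exact ⟨0, Submodule.zero_mem _, fun h => absurd h hm, fun _ => rfl⟩
  have hdc : d c = 0 := A.d0 (fun _ h => h.1) hc
  have hcm : c ∈ Sp b (fun p => dg p ≤ m) := Sp_mono (fun _ h => h.2) hc
  have hdm : ∀ v ∈ Sp b (fun p => dg p ≤ m), d v ∈ Sp b (fun p => dg p ≤ m) := fun v hv =>
    Sp_map d _ (fun p hp => Sp_mono (fun q hq => hq.2.le.trans hp) (A.dL p)) hv
  have hεd : m ∈ M → ∀ v ∈ Sp b (fun p => dg p ≤ m), ε (d v) = 0 := fun hm v hv =>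
    Sp_eq (ε ∘ₗ d) 0 (fun p hp => A.εd m hm p hp) hv
  let V := Sp b (fun p => dg p ≤ m)
  let dV : V →ₗ[k] V := d.restrict hdm
  obtain ⟨s0, hs0⟩ := LinearMap.exists_rightInverse_of_surjective dV.rangeRestrict
    dV.range_rangeRestrict
  obtain ⟨s, hs⟩ := LinearMap.exists_extend s0
  have hsd : ∀ v : V, dV (s (dV v)) = dV v := by
    intro v
    have h1 := LinearMap.congr_fun hs (dV.rangeRestrict v)
    have h2 := LinearMap.congr_fun hs0 (dV.rangeRestrict v)
    have h3 := congrArg Subtype.val h2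
    change s (dV v) = s0 (dV.rangeRestrict v) at h1
    change dV (s0 (dV.rangeRestrict v)) = dV v at h3
    rw [h1, h3]
  let εV : V →ₗ[k] k := ε ∘ₗ V.subtype
  let cV : V := ⟨c, hcm⟩
  have hdcV : dV cV = 0 := Subtype.ext hdc
  let πV : V →ₗ[k] V := εV.smulRight cV
  let s' : V →ₗ[k] V := s - πV ∘ₗ s
  have hdπ : ∀ v, dV (πV v) = 0 := fun v => by simp [πV, hdcV]
  have hs'd : ∀ v : V, dV (s' (dV v)) = dV v := fun v => by simp [s', hsd, hdπ]
  have hdd : ∀ v, dV (dV v) = 0 := fun v => Subtype.ext (A.dd v)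
  have hπd : ∀ v, πV (dV v) = 0 := by
    intro v
    by_cases hm : m ∈ M
    · have : εV (dV v) = 0 := hεd hm v v.2
      simp [πV, this]
    · have : cV = 0 := Subtype.ext (hc2 hm)
      simp [πV, this]
  have hεs : m ∈ M → ∀ v, εV (s' v) = 0 := by
    intro hm v
    have : εV cV = 1 := hc1 hm
    simp [s', πV, this]
  have hex : ∀ v : V, ∃ y, dV y = v - πV v - s' (dV v) := by
    intro v
    have h1 : dV (v - πV v - s' (dV v)) = 0 := by simp [hdπ, hs'd]
    obtain ⟨y, hy, hdy⟩ := A.exact m (v - πV v - s' (dV v) : V) (Submodule.coe_mem _)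
      (congrArg Subtype.val h1) (by
        intro hm
        change εV (v - πV v - s' (dV v)) = 0
        have : εV cV = 1 := hc1 hm
        simp [hεs hm, πV, this])
    exact ⟨⟨y, hy⟩, Subtype.ext hdy⟩
  let hV : V →ₗ[k] V := s' ∘ₗ (LinearMap.id - πV - s' ∘ₗ dV)
  have hhV : ∀ v, dV (hV v) + hV (dV v) = v - πV v := by
    intro v
    obtain ⟨y, hy⟩ := hex v
    have e1 : hV v = s' (dV y) := by rw [hy]; simp [hV]
    have e2 : hV (dV v) = s' (dV v) := by simp [hV, hπd, hdd]
    rw [e1, hs'd, hy, e2]; abel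
  obtain ⟨h, hh⟩ := LinearMap.exists_extend (V.subtype ∘ₗ hV)
  have hh' : ∀ v : V, h v = hV v := fun v => LinearMap.congr_fun hh v
  refine ⟨h, ε.smulRight c, ?_, ?_, ?_, ?_, ?_, c, fun v => by simp⟩
  · intro v hv
    rw [hh' ⟨v, hv⟩]
    exact Submodule.coe_mem _
  · intro v hv
    have e := congrArg Subtype.val (hhV ⟨v, hv⟩)
    rw [hh' ⟨v, hv⟩]
    have e2 := hh' (dV ⟨v, hv⟩)
    change h (d v) = _ at e2
    rw [e2]
    exact e
  · intro v hv
    exact congrArg Subtype.val (hπd ⟨v, hv⟩)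
  · intro v
    exact Submodule.smul_mem _ _ hc
  · intro hm
    ext v
    simp [hc2 hm]

lemma Sp_tmul {Q : P → Prop} {Q' : P' → Prop} {R : P × P' → Prop}
    (hR : ∀ p p', Q p → Q' p' → R (p, p')) {v : C} {w : C'} (hv : v ∈ Sp b Q)
    (hw : w ∈ Sp b' Q') : v ⊗ₜ[k] w ∈ Sp (b.tensorProduct b') R := by
  refine Sp_map ((TensorProduct.mk k C C').flip w) _ (fun p hp => ?_) hv
  refine Sp_map (TensorProduct.mk k C C' (b p)) _ (fun p' hp' => ?_) hw
  rw [TensorProduct.mk_apply, ← Basis.tensorProduct_apply]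
  exact Sp_basis _ (hR p p' hp hp')

/-- sign operator -/
noncomputable def sgn (b : Basis P k C) (hd : P → ℕ) : C →ₗ[k] C := b.constr k (fun p => (-1 : k) ^ hd p • b p)

lemma sgn_b (p : P) : sgn b hd (b p) = (-1 : k) ^ hd p • b p := by simp [sgn]

lemma sgn_sgn (v : C) : sgn b hd (sgn b hd v) = v := by
  have : sgn b hd ∘ₗ sgn b hd = LinearMap.id := b.ext (fun p => by
    simp [sgn_b, smul_smul, ← mul_pow])
  exact LinearMap.congr_fun this v

lemma sgn_Sp {Q : P → Prop} {v : C} (hv : v ∈ Sp b Q) : sgn b hd v ∈ Sp b Q :=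
  Sp_map _ _ (fun p hp => by rw [sgn_b]; exact Submodule.smul_mem _ _ (Sp_basis b hp)) hv

lemma IsAR.sgn_d (A : IsAR b hd dg d ε M) (v : C) : sgn b hd (d v) = - d (sgn b hd v) := by
  have : sgn b hd ∘ₗ d = - d ∘ₗ sgn b hd := b.ext (fun p => by
    simp only [LinearMap.comp_apply, LinearMap.neg_apply, sgn_b, map_smul]
    have := Sp_eq (sgn b hd) (-((-1 : k) ^ hd p) • LinearMap.id) (fun q hq => by
      rw [sgn_b, ← hq.1]; simp [pow_succ]) (A.dL p)
    rw [this]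
    simp)
  exact LinearMap.congr_fun this v

lemma IsAR.ε_sgn (A : IsAR b hd dg d ε M) (v : C) : ε (sgn b hd v) = ε v := by
  have : ε ∘ₗ sgn b hd = ε := b.ext (fun p => by
    simp only [LinearMap.comp_apply, sgn_b, map_smul]
    by_cases hp : hd p = 0
    · simp [hp]
    · simp [A.εhd p hp])
  exact LinearMap.congr_fun this v

set_option maxHeartbeats 1000000 in
lemma IsAR.tensor {M' : Set D} (A : IsAR b hd dg d ε M) (A' : IsAR b' hd' dg' d' ε' M')
    (hs : ∀ p q p', dg q < dg p → dg q ⊔ dg' p' < dg p ⊔ dg' p')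
    (hs' : ∀ p p' q', dg' q' < dg' p' → dg p ⊔ dg' q' < dg p ⊔ dg' p') :
    IsAR (b.tensorProduct b') (fun x => hd x.1 + hd' x.2) (fun x => dg x.1 ⊔ dg' x.2)
      (TensorProduct.map d LinearMap.id + TensorProduct.map (sgn b hd) d')
      (LinearMap.mul' k k ∘ₗ TensorProduct.map ε ε') (M ∩ M') := by
  have hbt : ∀ x : P × P', b.tensorProduct b' x = b x.1 ⊗ₜ[k] b' x.2 := fun x => by
    rw [← Basis.tensorProduct_apply]
  have ext' : ∀ {W : Type} [AddCommGroup W] [Module k W] (m : D) (f g : C ⊗[k] C' →ₗ[k] W),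
      (∀ v ∈ Sp b (fun p => dg p ≤ m), ∀ w ∈ Sp b' (fun p => dg' p ≤ m),
        f (v ⊗ₜ w) = g (v ⊗ₜ w)) →
      ∀ z ∈ Sp (b.tensorProduct b') (fun x => dg x.1 ⊔ dg' x.2 ≤ m), f z = g z := by
    intro W _ _ m f g h z hz
    refine Sp_eq f g (fun x hx => ?_) hz
    rw [hbt]
    exact h _ (Sp_basis b (le_sup_left.trans hx)) _ (Sp_basis b' (le_sup_right.trans hx))
  have map' : ∀ (m : D) (f : C ⊗[k] C' →ₗ[k] C ⊗[k] C'),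
      (∀ v ∈ Sp b (fun p => dg p ≤ m), ∀ w ∈ Sp b' (fun p => dg' p ≤ m),
        f (v ⊗ₜ w) ∈ Sp (b.tensorProduct b') (fun x => dg x.1 ⊔ dg' x.2 ≤ m)) →
      ∀ z ∈ Sp (b.tensorProduct b') (fun x => dg x.1 ⊔ dg' x.2 ≤ m),
        f z ∈ Sp (b.tensorProduct b') (fun x => dg x.1 ⊔ dg' x.2 ≤ m) := by
    intro m f h z hz
    refine Sp_map f _ (fun x hx => ?_) hz
    rw [hbt]
    exact h _ (Sp_basis b (le_sup_left.trans hx)) _ (Sp_basis b' (le_sup_right.trans hx))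
  have dm : ∀ m, ∀ v ∈ Sp b (fun p => dg p ≤ m), d v ∈ Sp b (fun p => dg p ≤ m) := fun m v hv =>
    Sp_map d _ (fun p hp => Sp_mono (fun q hq => hq.2.le.trans hp) (A.dL p)) hv
  have dm' : ∀ m, ∀ v ∈ Sp b' (fun p => dg' p ≤ m), d' v ∈ Sp b' (fun p => dg' p ≤ m) :=
    fun m v hv =>
    Sp_map d' _ (fun p hp => Sp_mono (fun q hq => hq.2.le.trans hp) (A'.dL p)) hv
  set DD : C ⊗[k] C' →ₗ[k] C ⊗[k] C' :=
    TensorProduct.map d LinearMap.id + TensorProduct.map (sgn b hd) d' with hDD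
  have DDt : ∀ v w, DD (v ⊗ₜ w) = d v ⊗ₜ w + sgn b hd v ⊗ₜ d' w := fun v w => by simp [hDD]
  have hDDD : ∀ v, DD (DD v) = 0 := by
    intro v
    have : DD ∘ₗ DD = 0 := by
      refine TensorProduct.ext' (fun x y => ?_)
      simp only [LinearMap.comp_apply, DDt, map_add, A.dd, A'.dd, A.sgn_d, sgn_sgn]
      simp [TensorProduct.neg_tmul]
    exact LinearMap.congr_fun this v
  refine ⟨?_, hDDD, ?_, ?_, ?_, ?_, ?_⟩
  · intro i
    have h1 : (⋃ u ∈ Set.Iic i, {p | hd p = u}).Finite :=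
      (Set.finite_Iic i).biUnion (fun u _ => A.fin u)
    have h2 : (⋃ u ∈ Set.Iic i, {p | hd' p = u}).Finite :=
      (Set.finite_Iic i).biUnion (fun u _ => A'.fin u)
    refine (h1.prod h2).subset ?_
    rintro ⟨p, p'⟩ hp
    simp only [Set.mem_ofPred_eq] at hp
    simp only [Set.mem_prod, Set.mem_iUnion, Set.mem_Iic, Set.mem_ofPred_eq, exists_prop]
    exact ⟨⟨_, by omega, rfl⟩, ⟨_, by omega, rfl⟩⟩
  · rintro ⟨p, p'⟩
    rw [hbt, DDt]
    refine Submodule.add_mem _ ?_ ?_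
    · refine Sp_tmul (Q' := fun q => q = p') ?_ (A.dL p) (Sp_basis b' rfl)
      rintro q _ ⟨h1, h2⟩ rfl
      exact ⟨by simp only; omega, hs _ _ _ h2⟩
    · refine Sp_tmul (Q := fun q => q = p) ?_ (sgn_Sp (Sp_basis b rfl)) (A'.dL p')
      rintro _ q rfl ⟨h1, h2⟩
      exact ⟨by simp only; omega, hs' _ _ _ h2⟩
  · rintro ⟨p, p'⟩ hp
    rw [hbt]
    simp only [LinearMap.comp_apply, TensorProduct.map_tmul, LinearMap.mul'_apply]
    by_cases h : hd p = 0
    · rw [A'.εhd p' (by simp only [ne_eq] at hp; omega), mul_zero]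
    · rw [A.εhd p h, zero_mul]
  · rintro m ⟨hm, hm'⟩ ⟨p, p'⟩ hp
    rw [hbt, DDt]
    simp only [LinearMap.comp_apply, TensorProduct.map_tmul, LinearMap.mul'_apply, map_add]
    rw [A.εd m hm p (le_sup_left.trans hp), A'.εd m hm' p' (le_sup_right.trans hp)]
    simp
  · intro m z hz hdz hε
    obtain ⟨h, π, h1, h2, h3, h4, h5, c, hc⟩ := A.contract m
    obtain ⟨h', π', h1', h2', h3', h4', h5', c', hc'⟩ := A'.contract m
    let H : C ⊗[k] C' →ₗ[k] C ⊗[k] C' :=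
      TensorProduct.map h LinearMap.id + TensorProduct.map π h'
    let Nn : C ⊗[k] C' →ₗ[k] C ⊗[k] C' :=
      TensorProduct.map (sgn b hd ∘ₗ h + h ∘ₗ sgn b hd) d'
    let Pp : C ⊗[k] C' →ₗ[k] C ⊗[k] C' := TensorProduct.map π π'
    have Ht : ∀ v w, H (v ⊗ₜ w) = h v ⊗ₜ w + π v ⊗ₜ h' w := fun v w => by simp [H]
    have Nt : ∀ v w, Nn (v ⊗ₜ w) = (sgn b hd (h v) + h (sgn b hd v)) ⊗ₜ d' w :=
      fun v w => by simp [Nn]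
    have dπ : ∀ v, d (π v) = 0 := fun v => A.d0 (fun _ h => h.1) (h4 v)
    have sπ : ∀ v, sgn b hd (π v) = π v := fun v =>
      Sp_eq (sgn b hd) LinearMap.id (fun p hp => by rw [sgn_b, hp.1]; simp) (h4 v)
    have πs : ∀ v, π (sgn b hd v) = π v := fun v => by rw [hc, hc, A.ε_sgn]
    have id1 : ∀ z ∈ Sp (b.tensorProduct b') (fun x => dg x.1 ⊔ dg' x.2 ≤ m),
        DD (H z) + H (DD z) = z - Pp z + Nn z := by
      refine ext' m (DD ∘ₗ H + H ∘ₗ DD) (LinearMap.id - Pp + Nn) (fun v hv w hw => ?_)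
      simp only [LinearMap.comp_apply, LinearMap.add_apply, LinearMap.sub_apply,
        LinearMap.id_apply, Ht, DDt, Nt, map_add, dπ, sπ, πs, h3 v hv, Pp,
        TensorProduct.map_tmul, TensorProduct.zero_tmul]
      have e1 : d (h v) = v - π v - h (d v) := by rw [← h2 v hv]; abel
      have e2 : d' (h' w) = w - π' w - h' (d' w) := by rw [← h2' w hw]; abel
      rw [e1, e2]
      simp only [TensorProduct.sub_tmul, TensorProduct.tmul_sub, TensorProduct.add_tmul]
      abel
    have Nm := map' m Nn (fun v hv w hw => by
      rw [Nt]
      exact Sp_tmul (Q := fun p => dg p ≤ m) (Q' := fun p => dg' p ≤ m)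
          (R := fun x => dg x.1 ⊔ dg' x.2 ≤ m)
        (fun p p' hp hp' => sup_le hp hp')
        (Submodule.add_mem _ (sgn_Sp (h1 v hv)) (h1 _ (sgn_Sp hv))) (dm' m w hw))
    have Hm := map' m H (fun v hv w hw => by
      rw [Ht]
      refine Submodule.add_mem _ (Sp_tmul (Q := fun p => dg p ≤ m) (Q' := fun p => dg' p ≤ m)
          (R := fun x => dg x.1 ⊔ dg' x.2 ≤ m)
        (fun p p' hp hp' => sup_le hp hp') (h1 v hv) hw)
        (Sp_tmul (Q := fun p => hd p = 0 ∧ dg p ≤ m) (Q' := fun p => dg' p ≤ m)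
          (R := fun x => dg x.1 ⊔ dg' x.2 ≤ m)
          (fun p p' hp hp' => sup_le hp.2 hp') (h4 v) (h1' w hw)))
    have hNN : Nn (Nn z) = 0 := by
      have : Nn ∘ₗ Nn = 0 := TensorProduct.ext' (fun x y => by
        simp [Nt, A'.dd])
      exact LinearMap.congr_fun this z
    have hPpN : Pp (Nn z) = 0 := by
      refine ext' m (Pp ∘ₗ Nn) 0 (fun v hv w hw => ?_) z hz
      simp only [LinearMap.comp_apply, Nt, Pp, TensorProduct.map_tmul, h3' w hw]
      simp
    have hPpz : Pp z = 0 := by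
      by_cases hm : m ∈ M
      · by_cases hm' : m ∈ M'
        · have e := hε ⟨hm, hm'⟩
          have : Pp = (LinearMap.mul' k k ∘ₗ TensorProduct.map ε ε').smulRight (c ⊗ₜ c') := by
            refine TensorProduct.ext' (fun x y => ?_)
            simp only [Pp, TensorProduct.map_tmul, hc, hc', LinearMap.smulRight_apply,
              LinearMap.comp_apply, LinearMap.mul'_apply, TensorProduct.smul_tmul_smul]
          rw [this, LinearMap.smulRight_apply, e, zero_smul]
        · simp [Pp, h5' hm']
      · simp [Pp, h5 hm]
    have i1 := id1 z hz
    rw [hdz, hPpz, map_zero, add_zero, sub_zero] at i1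
    have hdN : DD (Nn z) = 0 := by
      have := congrArg DD i1
      rw [hDDD, map_add, hdz, zero_add] at this
      exact this.symm
    have i2 := id1 (Nn z) (Nm z hz)
    rw [hdN, hPpN, hNN, map_zero, add_zero, sub_zero, add_zero] at i2
    refine ⟨H z - H (Nn z), Submodule.sub_mem _ (Hm _ hz) (Hm _ (Nm _ hz)), ?_⟩
    rw [map_sub, i1, i2]; simp
  · rintro m ⟨hm, hm'⟩
    obtain ⟨c, hc, h1⟩ := A.surj m hm
    obtain ⟨c', hc', h1'⟩ := A'.surj m hm'
    refine ⟨c ⊗ₜ c', Sp_tmul ?_ hc hc', by simp [h1, h1']⟩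
    rintro p p' ⟨h1, h2⟩ ⟨h3, h4⟩
    exact ⟨by simp [h1, h3], sup_le h2 h4⟩

end Abstract

section Convert
open Module

variable {k σ : Type} [Field k]

/-- degree `m` extraction -/
noncomputable def eMap {β : (σ →₀ ℕ) →₀ ℕ} (m : σ →₀ ℕ) :
    ResMod k σ β →ₗ[k] (ResIdx β →₀ k) := by
  classical
  exact
  { toFun := fun w => Finsupp.onFinset w.support
      (fun q => if q.1 ≤ m then MvPolynomial.coeff (m - q.1) (w q) else 0)
      (fun q hq => by
        rw [Finsupp.mem_support_iff]
        intro h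
        simp [h] at hq)
    map_add' := fun x y => by
      ext q
      simp only [Finsupp.onFinset_apply, Finsupp.add_apply, MvPolynomial.coeff_add]
      split_ifs <;> simp
    map_smul' := fun c x => by
      ext q
      simp only [Finsupp.onFinset_apply, Finsupp.smul_apply, MvPolynomial.coeff_smul]
      split_ifs <;> simp }

open Classical in
lemma eMap_apply {β : (σ →₀ ℕ) →₀ ℕ} (m : σ →₀ ℕ) (w : ResMod k σ β) (q : ResIdx β) :
    eMap m w q = if q.1 ≤ m then MvPolynomial.coeff (m - q.1) (w q) else 0 := rfl

/-- homogenization -/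
noncomputable def tMap {β : (σ →₀ ℕ) →₀ ℕ} (m : σ →₀ ℕ) :
    (ResIdx β →₀ k) →ₗ[k] ResMod k σ β :=
  { toFun := fun w => Finsupp.onFinset w.support
      (fun q => MvPolynomial.monomial (m - q.1) (w q))
      (fun q hq => by
        rw [Finsupp.mem_support_iff]
        intro h
        simp [h] at hq)
    map_add' := fun x y => by
      ext q
      simp [Finsupp.onFinset_apply]
    map_smul' := fun c x => by
      ext q
      simp only [Finsupp.onFinset_apply, Finsupp.smul_apply, RingHom.id_apply, map_smul] }

lemma tMap_apply {β : (σ →₀ ℕ) →₀ ℕ} (m : σ →₀ ℕ) (w : ResIdx β →₀ k) (q : ResIdx β) :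
    tMap m w q = MvPolynomial.monomial (m - q.1) (w q) := rfl

lemma tMap_single {β : (σ →₀ ℕ) →₀ ℕ} (m : σ →₀ ℕ) (p : ResIdx β) (a : k) :
    tMap m (Finsupp.single p a) = Finsupp.single p (MvPolynomial.monomial (m - p.1) a) := by
  classical
  ext1 q
  rw [tMap_apply, Finsupp.single_apply, Finsupp.single_apply]
  split_ifs with h
  · rw [h]
  · simp

/-- standard basis -/
noncomputable abbrev sb (k P : Type) [Field k] : Basis P k (P →₀ k) := Finsupp.basisSingleOne

lemma eMap_tMap {β : (σ →₀ ℕ) →₀ ℕ} (m : σ →₀ ℕ) (z : ResIdx β →₀ k)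
    (hz : z ∈ Sp (sb k (ResIdx β)) (fun p => p.1 ≤ m)) : eMap m (tMap m z) = z := by
  classical
  ext q
  rw [eMap_apply, tMap_apply]
  split_ifs with h
  · simp
  · have := Sp_repr hz h
    simpa using this.symm

lemma eMap_mem {β : (σ →₀ ℕ) →₀ ℕ} (m : σ →₀ ℕ) (w : ResMod k σ β) :
    eMap m w ∈ Sp (sb k (ResIdx β)) (fun p => p.1 ≤ m) := by
  classical
  rw [Sp_iff]
  intro p hp
  by_contra h
  apply hp
  simp [eMap_apply, h]

lemma eMap_shift {β : (σ →₀ ℕ) →₀ ℕ} (m δ ν : σ →₀ ℕ) (a : k) (f : ResMod k σ β)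
    (hf : ∀ q, ∀ μ ∈ (f q).support, q.1 + μ = δ) [Decidable (δ + ν = m)] :
    eMap m (MvPolynomial.monomial ν a • f) = if δ + ν = m then a • eMap δ f else 0 := by
  classical
  have hf' : ∀ q μ, MvPolynomial.coeff μ (f q) ≠ 0 → q.1 + μ = δ := fun q μ h =>
    hf q μ (by rwa [MvPolynomial.mem_support_iff])
  ext q
  have e1 : (if δ + ν = m then a • eMap δ f else 0 : ResIdx β →₀ k) q =
    if δ + ν = m then a * (eMap δ f q) else 0 := by split_ifs <;> simp
  rw [e1, eMap_apply, eMap_apply, Finsupp.smul_apply, smul_eq_mul,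
    MvPolynomial.coeff_monomial_mul']
  by_cases h : δ + ν = m
  · subst h
    rw [if_pos rfl]
    by_cases hq : q.1 ≤ δ
    · rw [if_pos (hq.trans le_self_add), if_pos hq]
      have : δ + ν - q.1 = (δ - q.1) + ν := (tsub_add_eq_add_tsub hq).symm
      rw [this, if_pos le_add_self, add_tsub_cancel_right]
    · rw [if_neg hq, mul_zero]
      have : ∀ μ, MvPolynomial.coeff μ (f q) = 0 := by
        intro μ
        by_contra h
        exact hq (hf' q μ h ▸ le_self_add)
      simp [this]
  · rw [if_neg h]
    by_cases hq : q.1 ≤ m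
    · rw [if_pos hq]
      by_cases hν : ν ≤ m - q.1
      · rw [if_pos hν]
        have : MvPolynomial.coeff (m - q.1 - ν) (f q) = 0 := by
          by_contra h'
          have := hf' q _ h'
          apply h
          rw [← this, add_assoc, tsub_add_cancel_of_le hν, add_tsub_cancel_of_le hq]
        rw [this, mul_zero]
      · rw [if_neg hν]
    · rw [if_neg hq]

lemma tMap_shift {β : (σ →₀ ℕ) →₀ ℕ} (m δ : σ →₀ ℕ) (f : ResMod k σ β) (hδ : δ ≤ m)
    (hf : ∀ q, ∀ μ ∈ (f q).support, q.1 + μ = δ) :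
    (MvPolynomial.monomial (m - δ) (1 : k)) • f = tMap m (eMap δ f) := by
  classical
  have hf' : ∀ q μ, MvPolynomial.coeff μ (f q) ≠ 0 → q.1 + μ = δ := fun q μ h =>
    hf q μ (by rwa [MvPolynomial.mem_support_iff])
  ext1 q
  rw [tMap_apply, eMap_apply, Finsupp.smul_apply, smul_eq_mul]
  by_cases hq : q.1 ≤ δ
  · rw [if_pos hq]
    have : f q = MvPolynomial.monomial (δ - q.1) (MvPolynomial.coeff (δ - q.1) (f q)) := by
      ext μ
      rw [MvPolynomial.coeff_monomial]
      split_ifs with h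
      · rw [h]
      · by_contra h'
        exact h (by rw [← hf' q μ h', add_tsub_cancel_left])
    conv_lhs => rw [this]
    rw [MvPolynomial.monomial_mul, one_mul, tsub_add_tsub_cancel hδ hq]
  · rw [if_neg hq]
    have : f q = 0 := by
      ext μ
      by_contra h
      exact hq (hf' q μ h ▸ le_self_add)
    simp [this]

variable {I : Ideal (MvPolynomial σ k)} (R : MinimalMultigradedFreeResolutionQuot k σ I)

/-- scalar differential -/
noncomputable def dk (i : ℕ) : (ResIdx (R.β (i+1)) →₀ k) →ₗ[k] (ResIdx (R.β i) →₀ k) :=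
  (sb k (ResIdx (R.β (i+1)))).constr k (fun p => eMap p.1 (R.d i (Finsupp.single p 1)))

lemma dk_b (i : ℕ) (p) :
    dk R i (sb k _ p) = eMap p.1 (R.d i (Finsupp.single p 1)) := by
  unfold dk
  rw [Basis.constr_basis]

lemma resMod_ext {W : Type} [AddCommGroup W] [Module k W] {β : (σ →₀ ℕ) →₀ ℕ}
    (f g : ResMod k σ β →ₗ[k] W)
    (h : ∀ p ν, f (Finsupp.single p (MvPolynomial.monomial ν 1)) =
      g (Finsupp.single p (MvPolynomial.monomial ν 1))) : f = g := by
  refine Finsupp.lhom_ext' (fun p => MvPolynomial.linearMap_ext (fun ν => LinearMap.ext_ring ?_))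
  exact h p ν

lemma single_monomial {β : (σ →₀ ℕ) →₀ ℕ} (p : ResIdx β) (ν : σ →₀ ℕ) :
    (Finsupp.single p (MvPolynomial.monomial ν 1) : ResMod k σ β) =
      MvPolynomial.monomial ν (1 : k) • Finsupp.single p (1 : MvPolynomial σ k) := by
  simp

lemma eMap_single {β : (σ →₀ ℕ) →₀ ℕ} (m : σ →₀ ℕ) (p : ResIdx β) (ν : σ →₀ ℕ)
    [Decidable (p.1 + ν = m)] :
    eMap m (Finsupp.single p (MvPolynomial.monomial ν (1 : k))) =
      if p.1 + ν = m then sb k _ p else 0 := by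
  classical
  rw [single_monomial, eMap_shift m p.1 ν 1 (Finsupp.single p 1)]
  · congr 1
    rw [one_smul]
    ext q
    rw [eMap_apply]
    simp only [sb, Finsupp.coe_basisSingleOne, Finsupp.single_apply]
    by_cases h : p = q
    · subst h; simp
    · simp [h]
  · intro q μ hμ
    rw [MvPolynomial.mem_support_iff, Finsupp.single_apply] at hμ
    split_ifs at hμ with h
    · subst h
      rw [MvPolynomial.coeff_one] at hμ
      have : μ = 0 := by
        by_contra h'
        exact hμ (if_neg (Ne.symm h'))
      simp [this]
    · simp at hμ

lemma eMap_d (i : ℕ) (m : σ →₀ ℕ) (w : ResMod k σ (R.β (i+1))) :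
    eMap m (R.d i w) = dk R i (eMap m w) := by
  classical
  have : eMap m ∘ₗ (R.d i).restrictScalars k = dk R i ∘ₗ eMap m := by
    refine resMod_ext _ _ (fun p ν => ?_)
    simp only [LinearMap.comp_apply, LinearMap.restrictScalars_apply]
    rw [eMap_single, single_monomial, map_smul, eMap_shift m p.1 ν 1 _ (R.homog_d i p), one_smul]
    split_ifs
    · rw [dk_b]
    · rw [map_zero]
  exact LinearMap.congr_fun this w

lemma d_tMap (i : ℕ) (m : σ →₀ ℕ) (z : ResIdx (R.β (i+1)) →₀ k)
    (hz : z ∈ Sp (sb k _) (fun p => p.1 ≤ m)) : R.d i (tMap m z) = tMap m (dk R i z) := by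
  refine Sp_eq ((R.d i).restrictScalars k ∘ₗ tMap m) (tMap m ∘ₗ dk R i) (fun p hp => ?_) hz
  simp only [LinearMap.comp_apply, LinearMap.restrictScalars_apply]
  rw [dk_b, ← tMap_shift m p.1 _ hp (R.homog_d i p), Finsupp.coe_basisSingleOne, tMap_single,
    single_monomial, map_smul]

lemma dk_dk (i : ℕ) (z : ResIdx (R.β (i+1+1)) →₀ k) : dk R i (dk R (i+1) z) = 0 := by
  have : dk R i ∘ₗ dk R (i+1) = 0 := by
    refine (sb k _).ext (fun p => ?_)
    rw [LinearMap.comp_apply, dk_b, ← eMap_d]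
    have : R.d i (R.d (i+1) (Finsupp.single p 1)) = 0 := by
      rw [← LinearMap.mem_ker, R.exact]; exact ⟨_, rfl⟩
    rw [this]; simp
  exact LinearMap.congr_fun this z

/-- augmentation representatives -/
noncomputable def cc (p : ResIdx (R.β 0)) : MvPolynomial σ k := (R.homog_ε p).choose

noncomputable def εk : (ResIdx (R.β 0) →₀ k) →ₗ[k] k :=
  (sb k _).constr k (fun p => MvPolynomial.coeff p.1 (cc R p))

lemma cc_eq (p) : cc R p = MvPolynomial.monomial p.1 (MvPolynomial.coeff p.1 (cc R p)) := by
  classical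
  have := (R.homog_ε p).choose_spec.2
  ext μ
  rw [MvPolynomial.coeff_monomial]
  split_ifs with h
  · rw [h]
  · by_contra h'
    exact h (this μ (by rwa [MvPolynomial.mem_support_iff])).symm

noncomputable def cmap : ResMod k σ (R.β 0) →ₗ[MvPolynomial σ k] MvPolynomial σ k :=
  Finsupp.linearCombination _ (cc R)

lemma mk_cmap (w) : Ideal.Quotient.mk I (cmap R w) = R.ε w := by
  have : (Ideal.Quotient.mkₐ (MvPolynomial σ k) I).toLinearMap ∘ₗ cmap R = R.ε := by
    refine Finsupp.lhom_ext' (fun p => LinearMap.ext_ring ?_)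
    simp only [LinearMap.comp_apply, Finsupp.lsingle_apply, cmap,
      Finsupp.linearCombination_single, one_smul]
    exact (R.homog_ε p).choose_spec.1
  exact LinearMap.congr_fun this w

lemma coeff_cmap (m : σ →₀ ℕ) (w) : MvPolynomial.coeff m (cmap R w) = εk R (eMap m w) := by
  classical
  have : (MvPolynomial.lcoeff k m) ∘ₗ (cmap R).restrictScalars k = εk R ∘ₗ eMap m := by
    refine resMod_ext _ _ (fun p ν => ?_)
    simp only [LinearMap.comp_apply, LinearMap.restrictScalars_apply]
    rw [eMap_single, single_monomial, map_smul]
    simp only [cmap, Finsupp.linearCombination_single, one_mul, smul_eq_mul,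
      MvPolynomial.lcoeff_apply]
    rw [cc_eq, MvPolynomial.monomial_mul, MvPolynomial.coeff_monomial, one_mul, add_comm p.1 ν]
    split_ifs with h
    · unfold εk
      rw [Basis.constr_basis]
    · simp
  exact LinearMap.congr_fun this w

lemma cmap_tMap (m : σ →₀ ℕ) (z) (hz : z ∈ Sp (sb k (ResIdx (R.β 0))) (fun p => p.1 ≤ m)) :
    cmap R (tMap m z) = MvPolynomial.monomial m (εk R z) := by
  refine Sp_eq ((cmap R).restrictScalars k ∘ₗ tMap m) (MvPolynomial.monomial m ∘ₗ εk R)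
    (fun p hp => ?_) hz
  simp only [LinearMap.comp_apply, LinearMap.restrictScalars_apply]
  have : εk R (sb k _ p) = MvPolynomial.coeff p.1 (cc R p) := by
    unfold εk
    rw [Basis.constr_basis]
  rw [this, Finsupp.coe_basisSingleOne, tMap_single, single_monomial, map_smul]
  simp only [cmap, Finsupp.linearCombination_single, one_mul, smul_eq_mul]
  conv_lhs => rw [cc_eq]
  rw [MvPolynomial.monomial_mul, one_mul, tsub_add_cancel_of_le hp]

end Convert

section Build
open Module

variable {k σ : Type} [Field k]
variable {I : Ideal (MvPolynomial σ k)} (R : MinimalMultigradedFreeResolutionQuot k σ I)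

abbrev TP : Type := Σ i, ResIdx (R.β i)

abbrev tmk (i : ℕ) (p : ResIdx (R.β i)) : TP R := ⟨i, p⟩

lemma tmk_inj (i : ℕ) : Function.Injective (tmk R i) := fun p q h => by
  simpa [tmk] using h

noncomputable def tin (i : ℕ) : (ResIdx (R.β i) →₀ k) →ₗ[k] (TP R →₀ k) :=
  Finsupp.lmapDomain k k (tmk R i)

noncomputable def tco (i : ℕ) : (TP R →₀ k) →ₗ[k] (ResIdx (R.β i) →₀ k) :=
  Finsupp.lcomapDomain (tmk R i) (tmk_inj R i)

lemma tin_b (i : ℕ) (p) : tin R i (sb k _ p) = sb k (TP R) ⟨i, p⟩ := by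
  simp [tin, sb]

lemma tco_apply (i : ℕ) (z : TP R →₀ k) (p) : tco R i z p = z ⟨i, p⟩ := rfl

lemma tco_b (i : ℕ) (p) : tco R i (sb k (TP R) ⟨i, p⟩) = sb k _ p := by
  classical
  ext q
  rw [tco_apply]
  simp [sb, Finsupp.single_apply]

lemma tco_b_ne (i j : ℕ) (h : i ≠ j) (p) : tco R i (sb k (TP R) ⟨j, p⟩) = 0 := by
  classical
  ext q
  rw [tco_apply]
  simp only [sb, Finsupp.coe_basisSingleOne, Finsupp.single_apply]
  rw [if_neg]
  · rfl
  · intro h'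
    exact h (congrArg Sigma.fst h').symm

noncomputable def dfun : TP R → (TP R →₀ k)
  | ⟨0, _⟩ => 0
  | ⟨i+1, p⟩ => tin R i (dk R i (sb k _ p))

noncomputable def td : (TP R →₀ k) →ₗ[k] (TP R →₀ k) := (sb k (TP R)).constr k (dfun R)

lemma td_b0 (p) : td R (sb k (TP R) ⟨0, p⟩) = 0 := by
  unfold td; rw [Basis.constr_basis]; rfl

lemma td_bs (i p) : td R (sb k (TP R) ⟨i+1, p⟩) = tin R i (dk R i (sb k _ p)) := by
  unfold td; rw [Basis.constr_basis]; rfl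

lemma td_tin (i z) : td R (tin R (i+1) z) = tin R i (dk R i z) := by
  have : td R ∘ₗ tin R (i+1) = tin R i ∘ₗ dk R i := by
    refine (sb k _).ext (fun p => ?_)
    rw [LinearMap.comp_apply, tin_b, td_bs]; rfl
  exact LinearMap.congr_fun this z

lemma td_tin0 (z) : td R (tin R 0 z) = 0 := by
  have : td R ∘ₗ tin R 0 = 0 := by
    refine (sb k _).ext (fun p => ?_)
    rw [LinearMap.comp_apply, tin_b, td_b0]; rfl
  exact LinearMap.congr_fun this z

lemma tco_tin (i z) : tco R i (tin R i z) = z := by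
  have : tco R i ∘ₗ tin R i = LinearMap.id := by
    refine (sb k _).ext (fun p => ?_)
    rw [LinearMap.comp_apply, tin_b, tco_b]; rfl
  exact LinearMap.congr_fun this z

lemma tco_tin_ne (i j : ℕ) (h : i ≠ j) (z) : tco R i (tin R j z) = 0 := by
  have : tco R i ∘ₗ tin R j = 0 := by
    refine (sb k _).ext (fun p => ?_)
    rw [LinearMap.comp_apply, tin_b, tco_b_ne R i j h]; rfl
  exact LinearMap.congr_fun this z

lemma tco_td (i z) : tco R i (td R z) = dk R i (tco R (i+1) z) := by
  have : tco R i ∘ₗ td R = dk R i ∘ₗ tco R (i+1) := by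
    refine (sb k _).ext ?_
    rintro ⟨j, p⟩
    simp only [LinearMap.comp_apply]
    by_cases h : j = i + 1
    · subst h
      rw [td_bs, tco_tin, tco_b]
    · rw [tco_b_ne R (i+1) j (Ne.symm h), map_zero]
      cases j with
      | zero => rw [td_b0, map_zero]
      | succ j => rw [td_bs, tco_tin_ne]; omega
  exact LinearMap.congr_fun this z

lemma tco_ext (z w : TP R →₀ k) (h : ∀ i, tco R i z = tco R i w) : z = w := by
  ext ⟨i, p⟩
  rw [← tco_apply, h, tco_apply]

lemma tfinsum (z : TP R →₀ k) :
    ∃ s : Finset ℕ, ∀ i, i ∉ s → tco R i z = 0 := by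
  classical
  refine ⟨z.support.image Sigma.fst, fun i hi => ?_⟩
  ext p
  rw [tco_apply]
  by_contra h
  apply hi
  rw [Finset.mem_image]
  exact ⟨⟨i, p⟩, by simpa using h, rfl⟩

noncomputable def tε : (TP R →₀ k) →ₗ[k] k := εk R ∘ₗ tco R 0

lemma tSp (Q : (σ →₀ ℕ) → Prop) (z : TP R →₀ k) :
    z ∈ Sp (sb k (TP R)) (fun x => Q x.2.1) ↔
      ∀ i, tco R i z ∈ Sp (sb k _) (fun p => Q p.1) := by
  simp only [Sp_iff]
  constructor
  · intro h i p hp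
    exact h ⟨i, p⟩ hp
  · rintro h ⟨i, p⟩ hp
    exact h i p hp

lemma tin_Sp (i : ℕ) (Q : (σ →₀ ℕ) → Prop) (z) (hz : z ∈ Sp (sb k _) (fun p : ResIdx (R.β i) => Q p.1)) :
    tin R i z ∈ Sp (sb k (TP R)) (fun x => x.1 = i ∧ Q x.2.1) := by
  refine Sp_map (tin R i) _ (fun p hp => ?_) hz
  rw [tin_b]
  exact Sp_basis _ ⟨rfl, hp⟩

lemma dk_Sp (i : ℕ) (p : ResIdx (R.β (i+1))) :
    dk R i (sb k _ p) ∈ Sp (sb k _) (fun q => q.1 < p.1) := by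
  classical
  rw [Sp_iff]
  intro q hq
  rw [dk_b] at hq
  have hq' : eMap p.1 (R.d i (Finsupp.single p 1)) q ≠ 0 := hq
  rw [eMap_apply] at hq'
  split_ifs at hq' with h
  · refine lt_of_le_of_ne h (fun e => hq' ?_)
    rw [e, tsub_self]
    exact R.minimal i p q
  · exact absurd rfl hq'

theorem buildAR (hcoef : ∀ f ∈ I, ∀ m, MvPolynomial.coeff m f ≠ 0 →
      MvPolynomial.monomial m (1 : k) ∈ I)
    (hlow : ∀ m m' : σ →₀ ℕ, m ≤ m' → MvPolynomial.monomial m (1 : k) ∈ I →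
      MvPolynomial.monomial m' (1 : k) ∈ I) :
    IsAR (sb k (TP R)) (fun x => x.1) (fun x => x.2.1) (td R) (tε R)
      {m | MvPolynomial.monomial m (1 : k) ∉ I} where
  fin i := by
    have : {p : TP R | p.1 = i} = Set.range (Sigma.mk i) := by
      ext ⟨j, p⟩
      constructor
      · rintro rfl
        exact ⟨p, rfl⟩
      · rintro ⟨q, hq⟩
        exact (congrArg Sigma.fst hq).symm
    rw [this]
    have : Finite (ResIdx (R.β i)) := by
      let g : ResIdx (R.β i) → Σ m : (R.β i).support, Fin (R.β i m) := fun p =>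
        ⟨⟨p.1, by
          rw [Finsupp.mem_support_iff]
          intro h
          have := p.2.2
          omega⟩, p.2⟩
      refine Finite.of_injective g ?_
      rintro ⟨m, a⟩ ⟨m', a'⟩ h
      simp only [g, Sigma.mk.injEq, Subtype.mk.injEq] at h
      obtain ⟨rfl, h⟩ := h
      simpa using h
    exact Set.finite_range _
  dd v := by
    refine tco_ext R _ _ (fun i => ?_)
    rw [tco_td, tco_td, dk_dk, map_zero]
  dL := by
    rintro ⟨i, p⟩
    cases i with
    | zero => rw [td_b0]; exact Submodule.zero_mem _
    | succ i =>
      rw [td_bs]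
      refine Sp_mono ?_ (tin_Sp R i (fun m => m < p.1) _ (dk_Sp R i p))
      rintro q ⟨h1, h2⟩
      exact ⟨by rw [h1], h2⟩
  εhd := by
    rintro ⟨i, p⟩ h
    unfold tε
    rw [LinearMap.comp_apply, tco_b_ne R 0 i (Ne.symm h), map_zero]
  εd := by
    rintro m hm ⟨i, p⟩ hp
    unfold tε
    rw [LinearMap.comp_apply, tco_td]
    cases i with
    | zero => rw [tco_b_ne R _ _ (by omega), map_zero, map_zero]
    | succ i =>
      by_cases hi : i = 0
      · subst hi
        rw [tco_b, dk_b, ← coeff_cmap]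
        by_contra h
        refine hm (hlow _ _ hp (hcoef _ ?_ _ h))
        rw [← Ideal.Quotient.eq_zero_iff_mem, mk_cmap, ← LinearMap.mem_ker, R.exact0]
        exact ⟨_, rfl⟩
      · rw [tco_b_ne R _ _ (by omega), map_zero, map_zero]
  exact := by
    classical
    intro m z hz hdz hεz
    rw [tSp R (fun x => x ≤ m)] at hz
    have key : ∀ i, ∃ y ∈ Sp (sb k (ResIdx (R.β (i+1)))) (fun p => p.1 ≤ m),
        dk R i y = tco R i z := by
      intro i
      have : ∃ w, R.d i w = tMap m (tco R i z) := by
        cases i with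
        | zero =>
          have : tMap m (tco R 0 z) ∈ LinearMap.ker R.ε := by
            rw [LinearMap.mem_ker, ← mk_cmap, cmap_tMap R m _ (hz 0),
              Ideal.Quotient.eq_zero_iff_mem]
            by_cases hm : MvPolynomial.monomial m (1 : k) ∈ I
            · have := I.mul_mem_left (MvPolynomial.C (εk R (tco R 0 z))) hm
              rwa [MvPolynomial.C_mul_monomial, mul_one] at this
            · have : εk R (tco R 0 z) = 0 := hεz hm
              rw [this, map_zero]; exact I.zero_mem
          rw [R.exact0] at this
          exact this
        | succ i =>
          have : tMap m (tco R (i+1) z) ∈ LinearMap.ker (R.d i) := by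
            rw [LinearMap.mem_ker, d_tMap R i m _ (hz (i+1)), ← tco_td, hdz, map_zero, map_zero]
          rw [R.exact] at this
          exact this
      obtain ⟨w, hw⟩ := this
      refine ⟨eMap m w, eMap_mem m w, ?_⟩
      rw [← eMap_d, hw, eMap_tMap m _ (hz i)]
    choose y hy hdy using key
    obtain ⟨s, hs⟩ := tfinsum R z
    refine ⟨∑ i ∈ s, tin R (i+1) (y i), ?_, ?_⟩
    · refine Submodule.sum_mem _ (fun i _ => ?_)
      refine Sp_mono ?_ (tin_Sp R (i+1) (fun x => x ≤ m) _ (hy i))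
      rintro q ⟨_, h⟩
      exact h
    · rw [map_sum]
      refine tco_ext R _ _ (fun j => ?_)
      rw [map_sum]
      simp only [td_tin, hdy]
      by_cases hj : j ∈ s
      · rw [Finset.sum_eq_single_of_mem j hj, tco_tin]
        intro i _ hi
        exact tco_tin_ne R j i (Ne.symm hi) _
      · rw [hs j hj]
        refine Finset.sum_eq_zero (fun i hi => tco_tin_ne R j i ?_ _)
        rintro rfl
        exact hj hi
  surj := by
    classical
    intro m hm
    obtain ⟨w, hw⟩ := R.surj_ε (Ideal.Quotient.mk I (MvPolynomial.monomial m 1))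
    refine ⟨tin R 0 (eMap m w), tin_Sp R 0 (fun x => x ≤ m) _ (eMap_mem m w), ?_⟩
    unfold tε
    rw [LinearMap.comp_apply, tco_tin, ← coeff_cmap]
    rw [← mk_cmap, Ideal.Quotient.eq] at hw
    by_contra h
    refine hm (hcoef _ hw m ?_)
    rw [MvPolynomial.coeff_sub, MvPolynomial.coeff_monomial, if_pos rfl]
    exact sub_ne_zero.mpr h

lemma TP_card (i : ℕ) (m : σ →₀ ℕ) :
    Nat.card {x : TP R // x.1 = i ∧ x.2.1 = m} = R.β i m := by
  rw [← Nat.card_fin (R.β i m)]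
  refine Nat.card_congr (Equiv.symm (Equiv.ofBijective
    (fun a : Fin (R.β i m) => (⟨⟨i, ⟨m, a⟩⟩, rfl, rfl⟩ : {x : TP R // x.1 = i ∧ x.2.1 = m})) ⟨?_, ?_⟩))
  · intro a a' h
    simpa using h
  · rintro ⟨⟨j, ⟨m', a⟩⟩, h1, h2⟩
    dsimp only at h1
    subst h1
    dsimp only at h2
    subst h2
    exact ⟨a, rfl⟩

end Build

section Final
open Module

/-- indicator exponent -/
noncomputable def ind {n : ℕ} (A : Finset (Fin n)) : Fin n →₀ ℕ :=
  Finsupp.equivFunOnFinite.symm (fun x => if x ∈ A then 1 else 0)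

lemma ind_apply {n : ℕ} (A : Finset (Fin n)) (x) : ind A x = if x ∈ A then 1 else 0 := rfl

lemma ind_mono {n : ℕ} {A B : Finset (Fin n)} (h : A ⊆ B) : ind A ≤ ind B := by
  intro x
  rw [ind_apply, ind_apply]
  split_ifs with h1 h2
  · exact le_rfl
  · exact absurd (h h1) h2
  · exact Nat.zero_le _
  · exact le_rfl

lemma totalDeg_eq {n : ℕ} (m : Fin n →₀ ℕ) : totalDeg m = ∑ x, m x := by
  unfold totalDeg
  rw [Finsupp.sum_fintype]
  intro; rfl

lemma totalDeg_ind {n : ℕ} (A : Finset (Fin n)) : totalDeg (ind A) = A.card := by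
  rw [totalDeg_eq]
  simp [ind_apply]

lemma eq_ind {n : ℕ} (A : Finset (Fin n)) (m : Fin n →₀ ℕ) (h : m ≤ ind A)
    (hd : totalDeg m = A.card) : m = ind A := by
  rw [← totalDeg_ind, totalDeg_eq, totalDeg_eq] at hd
  ext x
  exact (Finset.sum_eq_sum_iff_of_le (fun x _ => h x)).1 hd x (Finset.mem_univ x)

lemma prodX {k : Type} [Field k] {n : ℕ} (F : Finset (Fin n)) :
    ∏ x ∈ F, (MvPolynomial.X x : MvPolynomial (Fin n) k) = MvPolynomial.monomial (ind F) 1 := by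
  rw [MvPolynomial.monomial_eq, Finsupp.prod_fintype]
  · simp [ind_apply, pow_ite, Finset.prod_ite_mem]
  · simp

/-- monomials outside the ideal -/
def MS {n : ℕ} (G : Finset (Finset (Fin n))) : Set (Fin n →₀ ℕ) := {m | ∀ F ∈ G, ¬ ind F ≤ m}

lemma MS_lower {n : ℕ} (G : Finset (Finset (Fin n))) : IsLowerSet (MS G) :=
  fun _ _ h hm F hF hle => hm F hF (hle.trans h)

lemma MS_inf {n : ℕ} (G : Finset (Finset (Fin n))) (m : Fin n →₀ ℕ) :
    m ∈ MS G ↔ m ⊓ ind (G.sup id) ∈ MS G := by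
  have : ∀ F ∈ G, (ind F ≤ m ⊓ ind (G.sup id) ↔ ind F ≤ m) := fun F hF => by
    rw [le_inf_iff, and_iff_left]
    exact ind_mono (Finset.le_sup (f := id) hF)
  exact forall₂_congr (fun F hF => by rw [this F hF])

lemma mem_G {k : Type} [Field k] {n : ℕ} (G : Finset (Finset (Fin n)))
    (f : MvPolynomial (Fin n) k) :
    f ∈ Ideal.span
      ((fun F : Finset (Fin n) => ∏ x ∈ F, (MvPolynomial.X x : MvPolynomial (Fin n) k)) '' ↑G) ↔
    ∀ m, MvPolynomial.coeff m f ≠ 0 → ∃ F ∈ G, ind F ≤ m := by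
  have : ((fun F : Finset (Fin n) => ∏ x ∈ F, (MvPolynomial.X x : MvPolynomial (Fin n) k)) '' ↑G)
    = (fun s => MvPolynomial.monomial s (1 : k)) '' (ind '' (G : Set (Finset (Fin n)))) := by
    rw [Set.image_image]
    refine Set.image_congr (fun F _ => prodX F)
  rw [this, MvPolynomial.mem_ideal_span_monomial_image]
  simp

lemma mono_G {k : Type} [Field k] {n : ℕ} (G : Finset (Finset (Fin n))) (m : Fin n →₀ ℕ) :
    MvPolynomial.monomial m (1 : k) ∈ Ideal.span
      ((fun F : Finset (Fin n) => ∏ x ∈ F, (MvPolynomial.X x : MvPolynomial (Fin n) k)) '' ↑G) ↔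
    ∃ F ∈ G, ind F ≤ m := by
  classical
  rw [mem_G]
  constructor
  · intro h
    exact h m (by rw [MvPolynomial.coeff_monomial, if_pos rfl]; exact one_ne_zero)
  · intro h m' hm'
    rw [MvPolynomial.coeff_monomial] at hm'
    split_ifs at hm' with e
    · exact e ▸ h
    · exact absurd rfl hm'

def HasAR (k : Type) [Field k] {n : ℕ} (M : Set (Fin n →₀ ℕ)) (B : Finset (Fin n)) (c : ℕ → ℕ) :
    Prop :=
  ∃ (P C : Type) (_ : AddCommGroup C) (_ : Module k C) (b : Basis P k C) (hd : P → ℕ)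
    (dg : P → (Fin n →₀ ℕ)) (d : C →ₗ[k] C) (ε : C →ₗ[k] k),
    IsAR b hd dg d ε M ∧ (∀ p, dg p ≤ ind B) ∧
      ∀ i, Nat.card {p // hd p = i ∧ dg p = ind B} = c i

lemma HasAR.unique {k : Type} [Field k] {n : ℕ} {M : Set (Fin n →₀ ℕ)} {B : Finset (Fin n)}
    {c c' : ℕ → ℕ} (h : HasAR k M B c) (h' : HasAR k M B c') (hM : IsLowerSet M) (i : ℕ) :
    c i = c' i := by
  obtain ⟨P, C, _, _, b, hd, dg, d, ε, A, -, hc⟩ := h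
  obtain ⟨P', C', _, _, b', hd', dg', d', ε', A', -, hc'⟩ := h'
  rw [← hc, ← hc']
  exact le_antisymm (A.card_le A' hM i _) (A'.card_le A hM i _)

lemma HasAR.ofRes {k : Type} [Field k] {n : ℕ} (G : Finset (Finset (Fin n)))
    (I : Ideal (MvPolynomial (Fin n) k))
    (hI : I = Ideal.span
      ((fun F : Finset (Fin n) => ∏ x ∈ F, MvPolynomial.X x) '' ↑G))
    (R : MinimalMultigradedFreeResolutionQuot k (Fin n) I) :
    HasAR k (MS G) (G.sup id) (fun i => R.gradedBetti i (((G.sup id).card : ℕ) : ℤ)) := by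
  have hM : {m | MvPolynomial.monomial m (1 : k) ∉ I} = MS G := by
    ext m
    show MvPolynomial.monomial m (1 : k) ∉ I ↔ ∀ F ∈ G, ¬ ind F ≤ m
    rw [hI, mono_G]
    push Not
    rfl
  have A := buildAR R (by
    intro f hf m hm
    rw [hI, mono_G]
    rw [hI, mem_G] at hf
    exact hf m hm) (by
    intro m m' h hm
    rw [hI, mono_G] at hm ⊢
    obtain ⟨F, hF, hle⟩ := hm
    exact ⟨F, hF, hle.trans h⟩)
  rw [hM] at A
  have hdeg := A.deg_le (ind (G.sup id)) (MS_inf G)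
  refine ⟨_, _, _, _, _, _, _, _, _, A, hdeg, fun i => ?_⟩
  rw [TP_card]
  unfold MinimalMultigradedFreeResolutionQuot.gradedBetti
  have key : ∀ m ∈ (R.β i).support, (totalDeg m : ℤ) = ((G.sup id).card : ℕ) → m = ind (G.sup id) := by
    intro m hm h
    refine eq_ind _ _ ?_ (by exact_mod_cast h)
    rw [Finsupp.mem_support_iff] at hm
    exact hdeg ⟨i, ⟨m, ⟨0, Nat.pos_of_ne_zero hm⟩⟩⟩
  symm
  beta_reduce
  rw [Finset.sum_eq_single (ind (G.sup id))]
  · intro m hm hne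
    rw [Finset.mem_filter] at hm
    exact absurd (key m hm.1 hm.2) hne
  · intro h
    by_contra h'
    apply h
    rw [Finset.mem_filter, Finsupp.mem_support_iff]
    exact ⟨h', by rw [totalDeg_ind]⟩

lemma HasAR.unit (k : Type) [Field k] {n : ℕ} :
    HasAR k (Set.univ : Set (Fin n →₀ ℕ)) ∅ (fun i => if i = 0 then 1 else 0) := by
  have h0 : (ind ∅ : Fin n →₀ ℕ) = 0 := by
    ext x; simp [ind_apply]
  refine ⟨Unit, k, inferInstance, inferInstance, Basis.singleton Unit k, fun _ => 0, fun _ => 0, 0,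
    LinearMap.id, ?_, fun _ => by simp, fun i => ?_⟩
  · exact
    { fin := fun i => Set.toFinite _
      dd := fun v => by simp
      dL := fun p => by rw [LinearMap.zero_apply]; exact Submodule.zero_mem _
      εhd := fun p h => absurd rfl h
      εd := fun m _ p _ => by simp
      exact := fun m z _ _ h => ⟨0, Submodule.zero_mem _, by
        have := h (Set.mem_univ m)
        simpa using this.symm⟩
      surj := fun m _ => ⟨1, by rw [Sp_iff]; exact fun p _ => ⟨rfl, by simp⟩, rfl⟩ }
  · rw [h0]
    beta_reduce
    split_ifs with h
    · subst h
      simp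
    · rw [Nat.card_eq_zero]
      left
      constructor
      rintro ⟨_, h1, _⟩
      exact h h1.symm

lemma sup_lt_aux {n : ℕ} {A B : Finset (Fin n)} (hAB : Disjoint A B) {p q p' : Fin n →₀ ℕ}
    (hp : p ≤ ind A) (hp' : p' ≤ ind B) (h : q < p) : q ⊔ p' < p ⊔ p' := by
  refine lt_of_le_of_ne (sup_le_sup_right h.le _) (fun e => h.ne ?_)
  ext x
  have e1 := DFunLike.congr_fun e x
  have h1 := hp x
  have h2 := hp' x
  have h3 := h.le x
  simp only [Finsupp.sup_apply] at e1
  rw [ind_apply] at h1 h2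
  by_cases hx : x ∈ A
  · have hxB : x ∉ B := Finset.disjoint_left.1 hAB hx
    rw [if_neg hxB] at h2
    have : p' x = 0 := by omega
    rw [this] at e1
    simpa using e1
  · rw [if_neg hx] at h1
    omega

lemma sup_eq_aux {n : ℕ} {A B : Finset (Fin n)} (hAB : Disjoint A B) {p p' : Fin n →₀ ℕ}
    (hp : p ≤ ind A) (hp' : p' ≤ ind B) : p ⊔ p' = ind (A ∪ B) ↔ p = ind A ∧ p' = ind B := by
  simp only [DFunLike.ext_iff, ← forall_and]
  refine forall_congr' (fun x => ?_)
  have h1 := hp x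
  have h2 := hp' x
  rw [Finsupp.sup_apply, ind_apply, ind_apply, ind_apply]
  rw [ind_apply] at h1 h2
  by_cases hx : x ∈ A
  · have hxB : x ∉ B := Finset.disjoint_left.1 hAB hx
    simp [hx, hxB] at *
    simp [h2]
  · by_cases hxB : x ∈ B
    · simp [hx, hxB] at *
      simp [h1]
    · simp [hx, hxB] at *

lemma HasAR.tensor {k : Type} [Field k] {n : ℕ} {M M' : Set (Fin n →₀ ℕ)} {B B' : Finset (Fin n)}
    {c c' : ℕ → ℕ} (hB : Disjoint B B') (h : HasAR k M B c) (h' : HasAR k M' B' c') :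
    HasAR k (M ∩ M') (B ∪ B') (fun i => ∑ x ∈ Finset.HasAntidiagonal.antidiagonal i, c x.1 * c' x.2) := by
  obtain ⟨P, C, _, _, b, hd, dg, d, ε, A, hdeg, hc⟩ := h
  obtain ⟨P', C', _, _, b', hd', dg', d', ε', A', hdeg', hc'⟩ := h'
  have T := A.tensor A' (fun p q p' h => sup_lt_aux hB (hdeg p) (hdeg' p') h)
    (fun p p' q' h => by
      rw [sup_comm (dg p), sup_comm (dg p)]
      exact sup_lt_aux hB.symm (hdeg' p') (hdeg p) h)
  refine ⟨_, _, _, _, _, _, _, _, _, T, fun x => ?_, fun i => ?_⟩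
  · exact sup_le ((hdeg x.1).trans (ind_mono Finset.subset_union_left))
      ((hdeg' x.2).trans (ind_mono Finset.subset_union_right))
  · have hf : ∀ i, Finite {p // hd p = i ∧ dg p = ind B} := fun i =>
      ((A.fin i).subset (fun p hp => hp.1) : {p | hd p = i ∧ dg p = ind B}.Finite)
    have hf' : ∀ i, Finite {p // hd' p = i ∧ dg' p = ind B'} := fun i =>
      ((A'.fin i).subset (fun p hp => hp.1) : {p | hd' p = i ∧ dg' p = ind B'}.Finite)
    simp only [← hc, ← hc', ← Nat.card_prod]
    rw [← Finset.sum_coe_sort, ← Nat.card_sigma]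
    refine Nat.card_congr
      { toFun := fun x => ⟨⟨(hd x.1.1, hd' x.1.2), by
            rw [Finset.HasAntidiagonal.mem_antidiagonal]; exact x.2.1⟩,
          ⟨x.1.1, rfl, ((sup_eq_aux hB (hdeg _) (hdeg' _)).1 x.2.2).1⟩,
          ⟨x.1.2, rfl, ((sup_eq_aux hB (hdeg _) (hdeg' _)).1 x.2.2).2⟩⟩
        invFun := fun y => ⟨(y.2.1.1, y.2.2.1), by
            have := y.1.2
            rw [Finset.HasAntidiagonal.mem_antidiagonal] at this
            rw [y.2.1.2.1, y.2.2.2.1]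
            exact this, (sup_eq_aux hB (hdeg _) (hdeg' _)).2 ⟨y.2.1.2.2, y.2.2.2.2⟩⟩
        left_inv := fun x => rfl
        right_inv := ?_ }
    rintro ⟨⟨⟨u, v⟩, huv⟩, ⟨p, hp, hp2⟩, ⟨p', hp', hp2'⟩⟩
    dsimp only at hp hp'
    subst hp hp'
    rfl

lemma sum_tuple (N : ℕ) (f : Fin (N+1) → ℕ → ℕ) (i : ℕ) :
    ∑ u ∈ Finset.Nat.antidiagonalTuple (N+1) i, ∏ r, f r (u r) =
      ∑ x ∈ Finset.HasAntidiagonal.antidiagonal i, f 0 x.1 *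
        ∑ u ∈ Finset.Nat.antidiagonalTuple N x.2, ∏ r : Fin N, f r.succ (u r) := by
  simp only [Finset.mul_sum]
  rw [Finset.sum_sigma']
  refine Finset.sum_bij'
    (fun u _ => ⟨(u 0, ∑ r : Fin N, u r.succ), fun r => u r.succ⟩)
    (fun x _ => Fin.cons x.1.1 x.2) ?_ ?_ ?_ ?_ ?_
  · intro u hu
    rw [Finset.Nat.mem_antidiagonalTuple, Fin.sum_univ_succ] at hu
    simp [Finset.Nat.mem_antidiagonalTuple, hu]
  · rintro ⟨⟨a, b⟩, u⟩ hx
    simp only [Finset.mem_sigma, Finset.HasAntidiagonal.mem_antidiagonal, Finset.Nat.mem_antidiagonalTuple] at hx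
    simp [Finset.Nat.mem_antidiagonalTuple, Fin.sum_univ_succ, hx]
  · intro u _
    exact Fin.cons_self_tail u
  · rintro ⟨⟨a, b⟩, u⟩ hx
    simp only [Finset.mem_sigma, Finset.HasAntidiagonal.mem_antidiagonal, Finset.Nat.mem_antidiagonalTuple] at hx
    simp [hx.2]
  · intro u _
    rw [Fin.prod_univ_succ]

lemma HasAR.fin {k : Type} [Field k] {n : ℕ} (N : ℕ) (M : Fin N → Set (Fin n →₀ ℕ))
    (B : Fin N → Finset (Fin n)) (c : Fin N → ℕ → ℕ)
    (hB : ∀ r r', r ≠ r' → Disjoint (B r) (B r')) (h : ∀ r, HasAR k (M r) (B r) (c r)) :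
    HasAR k (⋂ r, M r) (Finset.univ.biUnion B)
      (fun i => ∑ u ∈ Finset.Nat.antidiagonalTuple N i, ∏ r, c r (u r)) := by
  induction N with
  | zero =>
    have := HasAR.unit k (n := n)
    convert this using 1
    · simp
    · simp
    · funext i
      cases i with
      | zero => simp
      | succ i => simp
  | succ N ih =>
    have := HasAR.tensor ?_ (h 0) (ih (fun r => M r.succ) (fun r => B r.succ) (fun r => c r.succ)
      (fun r r' hr => hB _ _ (fun e => hr (Fin.succ_injective _ e))) (fun r => h r.succ))
    · convert this using 1
      · ext m
        simp [Fin.forall_fin_succ]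
      · ext m
        simp [Fin.exists_fin_succ]
      · funext i
        rw [sum_tuple]
    · rw [Finset.disjoint_biUnion_right]
      intro r _
      exact hB _ _ (Fin.succ_ne_zero r).symm

end Final

/-- Let `I_1, …, I_N` be squarefree monomial ideals of
`S = k[x_1,…,x_n]` (given by their minimal generating sets of squarefree
monomials, encoded by the finite antichains `G r` of subsets of variables)
whose minimal generators contain no common variable, and suppose the least
common multiple of the minimal generators of `I_r` has degree `q_r` (for
squarefree monomials, `q_r` is the size of the union of the supports).  Then
`b_{i, q_1+⋯+q_N}(S/(I_1+⋯+I_N)) = ∑_{u_1+⋯+u_N=i} b_{u_1,q_1}(S/I_1) ⋯ b_{u_N,q_N}(S/I_N)`. -/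
theorem top_graded_betti_of_sum_of_variable_disjoint_ideals
    (k : Type) [Field k] (n N : ℕ)
    (G : Fin N → Finset (Finset (Fin n)))
    (I : Fin N → Ideal (MvPolynomial (Fin n) k))
    (hI : ∀ r, I r = Ideal.span
      ((fun F : Finset (Fin n) => ∏ x ∈ F, MvPolynomial.X x) '' ↑(G r)))
    (hmin : ∀ r, ∀ F ∈ G r, ∀ F' ∈ G r, F ⊆ F' → F = F')
    (hdisj : ∀ r r' : Fin N, r ≠ r' → Disjoint ((G r).sup id) ((G r').sup id))
    (q : Fin N → ℕ) (hq : ∀ r, q r = ((G r).sup id).card)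
    (Rtot : MinimalMultigradedFreeResolutionQuot k (Fin n) (∑ r, I r))
    (Rr : ∀ r, MinimalMultigradedFreeResolutionQuot k (Fin n) (I r))
    (i : ℕ) :
    Rtot.gradedBetti i ((∑ r, q r : ℕ) : ℤ) =
      ∑ u ∈ Finset.Nat.antidiagonalTuple N i,
        ∏ r, (Rr r).gradedBetti (u r) ((q r : ℕ) : ℤ) := by
  classical
  have hsup : (Finset.univ.biUnion G).sup id = Finset.univ.biUnion (fun r => (G r).sup id) := by
    ext x
    simp only [Finset.mem_sup, Finset.mem_biUnion, Finset.mem_univ, true_and, id]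
    constructor
    · rintro ⟨F, ⟨r, hr⟩, hx⟩
      exact ⟨r, F, hr, hx⟩
    · rintro ⟨r, F, hr, hx⟩
      exact ⟨F, ⟨r, hr⟩, hx⟩
  have hIt : ∑ r, I r = Ideal.span
      ((fun F : Finset (Fin n) => ∏ x ∈ F, (MvPolynomial.X x : MvPolynomial (Fin n) k)) ''
        ↑(Finset.univ.biUnion G)) := by
    rw [Ideal.sum_eq_sup, Finset.sup_univ_eq_iSup]
    simp only [hI]
    rw [Finset.coe_biUnion]
    simp only [Finset.coe_univ, Set.mem_univ, Set.iUnion_true, Set.image_iUnion]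
    rw [Ideal.span, Submodule.span_iUnion]
  have hMt : MS (Finset.univ.biUnion G) = ⋂ r, MS (G r) := by
    ext m
    simp only [MS, Set.mem_iInter, Finset.mem_biUnion, Finset.mem_univ, true_and]
    constructor
    · intro h r F hF
      exact h F ⟨r, hF⟩
    · rintro h F ⟨r, hF⟩
      exact h r F hF
  have hcard : ∑ r, q r = ((Finset.univ.biUnion G).sup id).card := by
    rw [hsup, Finset.card_biUnion (fun r _ r' _ h => hdisj r r' h)]
    exact Finset.sum_congr rfl (fun r _ => hq r)
  have h1 := HasAR.ofRes _ _ hIt Rtot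
  have h2 := HasAR.fin N (fun r => MS (G r)) (fun r => (G r).sup id) _ hdisj
    (fun r => HasAR.ofRes (G r) (I r) (hI r) (Rr r))
  rw [← hMt, ← hsup] at h2
  have := h1.unique h2 (MS_lower _) i
  simp only [← hcard, ← hq] at this
  exact this
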